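/- For any prime power q and positive integer n, defining m_q^sym = liminf_{k→∞} μ_q^sym(k)/k, one has m_q^sym ≤ m_{q^n}^sym · μ_q^sym(n)/n. -/

import Mathlib

/-- A symmetric decomposition with `r` summands of the multiplication tensor of a degree-`n`
extension `L` (with `q ^ n` elements) of a finite field `K` with `q` elements. -/
structure SymMulDecomp (q n r : ℕ) where
  L : Type
  [fieldL : Field L]
  K : Subfield L
  cardL : Nat.card L = q ^ n
  cardK : Nat.card K = q
  x : Fin r → (L →ₗ[K] K)
  c : Fin r → L
  mul_eq : ∀ a b : L, a * b = ∑ i, ((x i a : L) * (x i b : L)) * c i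

/-- The symmetric bilinear complexity `μ_q^sym(n)` of multiplication in `F_{q^n}` over `F_q`. -/
noncomputable def muSym (q n : ℕ) : ℕ := sInf { r | Nonempty (SymMulDecomp q n r) }

/-- `m_q^sym = liminf_{k→∞} μ_q^sym(k)/k`. -/
noncomputable def mSym (q : ℕ) : ℝ :=
  Filter.liminf (fun k : ℕ => (muSym q k : ℝ) / k) Filter.atTop

/-- A bilinear map (given as a function) has a symmetric decomposition of length `r`. -/
def HasDec (K L : Type) [Field K] [Field L] [Algebra K L] (ι : Type) [Fintype ι]
    (B : L → L → L) : Prop :=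
  ∃ (x : ι → (L →ₗ[K] K)) (c : ι → L), ∀ a b : L, B a b = ∑ i, (x i a * x i b) • c i

theorem HasDec.congr {K L : Type} [Field K] [Field L] [Algebra K L] {ι κ : Type} [Fintype ι]
    [Fintype κ] {B : L → L → L} (e : κ ≃ ι) (h : HasDec K L ι B) : HasDec K L κ B := by
  obtain ⟨x, c, h⟩ := h
  refine ⟨x ∘ e, c ∘ e, fun a b => ?_⟩
  rw [h]
  exact (Equiv.sum_comp e (fun i => (x i a * x i b) • c i)).symm

/-- Some finite decomposition exists. -/
def ExDec (K L : Type) [Field K] [Field L] [Algebra K L] (B : L → L → L) : Prop :=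
  ∃ r : ℕ, HasDec K L (Fin r) B

theorem ExDec.zero {K L : Type} [Field K] [Field L] [Algebra K L] :
    ExDec K L (fun _ _ => 0) := ⟨0, fun i => i.elim0, fun i => i.elim0, by simp⟩

theorem ExDec.single {K L : Type} [Field K] [Field L] [Algebra K L] (x : L →ₗ[K] K) (c : L) :
    ExDec K L (fun a b => (x a * x b) • c) := ⟨1, fun _ => x, fun _ => c, by simp⟩

theorem ExDec.add {K L : Type} [Field K] [Field L] [Algebra K L] {B C : L → L → L}
    (hB : ExDec K L B) (hC : ExDec K L C) : ExDec K L (fun a b => B a b + C a b) := by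
  obtain ⟨r, x, c, h⟩ := hB
  obtain ⟨s, y, d, h'⟩ := hC
  refine ⟨r + s, HasDec.congr (finSumFinEquiv (m := r) (n := s)).symm
    ⟨Sum.elim x y, Sum.elim c d, fun a b => ?_⟩⟩
  simp [h, h']

theorem ExDec.sum {K L : Type} [Field K] [Field L] [Algebra K L] {ι : Type} (s : Finset ι)
    (B : ι → L → L → L) (h : ∀ i, ExDec K L (B i)) :
    ExDec K L (fun a b => ∑ i ∈ s, B i a b) := by
  classical
  induction s using Finset.induction_on with
  | empty => simpa using ExDec.zero
  | insert i s hi ih => simpa [Finset.sum_insert hi] using (h i).add ih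

theorem ExDec.polar {K L : Type} [Field K] [Field L] [Algebra K L] (x y : L →ₗ[K] K) (c : L) :
    ExDec K L (fun a b => (x a * y b) • c + (y a * x b) • c) := by
  have h := ((ExDec.single (x + y) c).add (ExDec.single x (-c))).add (ExDec.single y (-c))
  convert h using 3
  simp only [LinearMap.add_apply, smul_neg]
  module

theorem ExDec.symm {K L : Type} [Field K] [Field L] [Algebra K L] {ι : Type} (s : Finset ι)
    (x : ι → (L →ₗ[K] K)) (c : ι → ι → L) (hc : ∀ i j, c i j = c j i) :
    ExDec K L (fun a b => ∑ i ∈ s, ∑ j ∈ s, (x i a * x j b) • c i j) := by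
  classical
  induction s using Finset.induction_on with
  | empty => simpa using ExDec.zero
  | insert i s hi ih =>
    have h := ((ExDec.single (x i) (c i i)).add
      (ExDec.sum s _ (fun j => ExDec.polar (x i) (x j) (c i j)))).add ih
    convert h using 3
    simp only [Finset.sum_insert hi, Finset.sum_add_distrib]
    simp only [hc _ i]
    abel

theorem ExDec.mul (K L : Type) [Field K] [Field L] [Algebra K L] [FiniteDimensional K L] :
    ExDec K L (fun a b => a * b) := by
  let v := Module.finBasis K L
  have h := ExDec.symm Finset.univ (fun i => v.coord i) (fun i j => v i * v j)
    (fun i j => mul_comm _ _)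
  convert h using 3 with a b
  conv_lhs => rw [← v.sum_repr a, ← v.sum_repr b]
  rw [Finset.sum_mul_sum]
  simp [smul_smul, mul_comm]

theorem HasDec.mk' {K L : Type} [Field K] [Field L] [Algebra K L] {q n r : ℕ}
    (hK : Nat.card K = q) (hL : Nat.card L = q ^ n)
    (h : HasDec K L (Fin r) (fun a b => a * b)) : Nonempty (SymMulDecomp q n r) := by
  obtain ⟨x, c, h⟩ := h
  let e := (algebraMap K L).rangeRestrictFieldEquiv
  have he : ∀ k, ((e k : (algebraMap K L).fieldRange) : L) = algebraMap K L k := fun k => rfl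
  refine ⟨⟨L, (algebraMap K L).fieldRange, hL, ?_, fun i =>
    { toFun := fun a => e (x i a), map_add' := ?_, map_smul' := ?_ }, c, ?_⟩⟩
  · rw [← hK]; exact (Nat.card_congr e.toEquiv).symm
  · intro a b; simp
  · intro k a
    obtain ⟨k, rfl⟩ := e.surjective k
    have : (e k) • a = k • a := by
      rw [Algebra.smul_def k]; rfl
    simp [this]
  · intro a b
    refine (h a b).trans ?_
    refine Finset.sum_congr rfl fun i _ => ?_
    simp [he, Algebra.smul_def]

theorem SymMulDecomp.out {q n r : ℕ} (D : Nonempty (SymMulDecomp q n r)) :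
    ∃ (K L : Type) (_ : Field K) (_ : Field L) (_ : Algebra K L), Nat.card K = q ∧
      Nat.card L = q ^ n ∧ HasDec K L (Fin r) (fun a b => a * b) := by
  obtain ⟨⟨L, K, hL, hK, x, c, h⟩⟩ := D
  refine ⟨K, L, inferInstance, inferInstance, inferInstance, hK, hL, x, c, fun a b => ?_⟩
  exact h a b

theorem exists_ext (K : Type) [Field K] [Finite K] (n : ℕ) (hn : 0 < n) :
    ∃ (E : Type) (_ : Field E) (_ : Algebra K E), Nat.card E = Nat.card K ^ n := by
  obtain ⟨p, hp⟩ := CharP.exists K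
  have : Fact p.Prime := ⟨CharP.char_is_prime K p⟩
  have : NeZero n := ⟨hn.ne'⟩
  exact ⟨FiniteField.Extension K p n, inferInstance, inferInstance,
    FiniteField.natCard_extension K p n⟩

theorem dec_nonempty {q n : ℕ} (hq : IsPrimePow q) (hn : 0 < n) :
    Nonempty (SymMulDecomp q n (muSym q n)) := by
  refine Nat.sInf_mem (s := { r | Nonempty (SymMulDecomp q n r) }) ?_
  obtain ⟨p, k, hp, hk, rfl⟩ := hq
  have : Fact p.Prime := ⟨hp.nat_prime⟩
  have hc : Nat.card (GaloisField p k) = p ^ k := GaloisField.card p k hk.ne'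
  obtain ⟨E, _, _, hE⟩ := exists_ext (GaloisField p k) n hn
  have : Finite E := Nat.finite_of_card_ne_zero (by
    rw [hE, hc]; exact pow_ne_zero _ (pow_ne_zero _ hp.nat_prime.ne_zero))
  have : FiniteDimensional (GaloisField p k) E := Module.Finite.of_finite
  obtain ⟨r, hr⟩ := ExDec.mul (GaloisField p k) E
  exact ⟨r, hr.mk' hc (by rw [hE, hc])⟩

theorem HasDec.trans {K L M : Type} [Field K] [Field L] [Field M] [Algebra K L] [Algebra L M]
    [Algebra K M] [IsScalarTower K L M] {ι κ : Type} [Fintype ι] [Fintype κ]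
    (h : HasDec K L ι (fun a b => a * b)) (h' : HasDec L M κ (fun a b => a * b)) :
    HasDec K M (κ × ι) (fun a b => a * b) := by
  obtain ⟨x, c, h⟩ := h
  obtain ⟨y, d, h'⟩ := h'
  refine ⟨fun p => (x p.2) ∘ₗ ((y p.1).restrictScalars K), fun p => c p.2 • d p.1,
    fun a b => ?_⟩
  rw [h', Fintype.sum_prod_type]
  refine Finset.sum_congr rfl fun i _ => ?_
  have h1 := h (y i a) (y i b)
  beta_reduce at h1
  rw [h1, Finset.sum_smul]
  simp

theorem muSym_mul_le {q n m : ℕ} (hq : IsPrimePow q) (hn : 0 < n) (hm : 0 < m) :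
    muSym q (n * m) ≤ muSym (q ^ n) m * muSym q n := by
  obtain ⟨K, L, _, _, _, hK, hL, h⟩ := SymMulDecomp.out (dec_nonempty hq hn)
  obtain ⟨L', M, _, _, _, hL', hM, h'⟩ := SymMulDecomp.out (dec_nonempty (hq.pow hn.ne') hm)
  have hq0 : q ≠ 0 := hq.ne_zero
  have : Finite L := Nat.finite_of_card_ne_zero (by rw [hL]; positivity)
  have : Finite L' := Nat.finite_of_card_ne_zero (by rw [hL']; positivity)
  have := Fintype.ofFinite L
  have := Fintype.ofFinite L'
  let e : L' ≃+* L := FiniteField.ringEquivOfCardEq (by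
    rw [← Nat.card_eq_fintype_card, ← Nat.card_eq_fintype_card, hL, hL'])
  let _ : Algebra L M := ((algebraMap L' M).comp e.symm.toRingHom).toAlgebra
  let _ : Algebra K M := ((algebraMap L M).comp (algebraMap K L)).toAlgebra
  have : IsScalarTower K L M := IsScalarTower.of_algebraMap_eq fun _ => rfl
  have h'' : HasDec L M (Fin (muSym (q ^ n) m)) (fun a b => a * b) := by
    obtain ⟨x, c, h'⟩ := h'
    have hs : ∀ (l : L) (a : M), l • a = e.symm l • a := fun l a => by
      rw [Algebra.smul_def, Algebra.smul_def]; rfl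
    refine ⟨fun i => { toFun := fun a => e (x i a), map_add' := ?_, map_smul' := ?_ }, c, ?_⟩
    · intro a b; simp
    · intro l a; simp [hs]
    · intro a b
      rw [h']
      simp [hs]
  refine Nat.sInf_le (s := { r | Nonempty (SymMulDecomp q (n * m) r) }) ?_
  refine (HasDec.congr finProdFinEquiv.symm (h.trans h'')).mk' hK ?_
  rw [hM, pow_mul]

theorem HasDec.baseChange {K L E M : Type} [Field K] [Field L] [Field E] [Field M]
    [Algebra K L] [Algebra K E] [Algebra E M] (f : L →+* M)
    (hf : ∀ k : K, f (algebraMap K L k) = algebraMap E M (algebraMap K E k))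
    (hs : ⊤ ≤ Submodule.span E (Set.range f)) {ι : Type} [Fintype ι]
    (h : HasDec K L ι (fun a b => a * b)) : HasDec E M ι (fun a b => a * b) := by
  obtain ⟨x, c, h⟩ := h
  let v := Module.Basis.ofSpan hs
  have hv : ∀ j, ∃ l, f l = v j := fun j => Module.Basis.ofSpan_subset hs ⟨j, rfl⟩
  choose l hl using hv
  let y : ι → (M →ₗ[E] E) := fun i => v.constr E fun j => algebraMap K E (x i (l j))
  have hy : ∀ i j, y i (v j) = algebraMap K E (x i (l j)) := fun i j => by
    simp [y]
  refine ⟨y, fun i => f (c i), ?_⟩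
  let B : M →ₗ[E] M →ₗ[E] M :=
    ∑ i, LinearMap.mk₂ E (fun a b => (y i a * y i b) • f (c i))
      (by intros; simp; ring_nf; module) (by intros; simp [smul_smul, mul_assoc])
      (by intros; simp; ring_nf; module) (by intros; simp [smul_smul, mul_left_comm])
  have hB : LinearMap.mul E M = B := by
    refine v.ext fun j => v.ext fun k => ?_
    simp only [B, LinearMap.sum_apply, LinearMap.mk₂_apply, LinearMap.mul_apply_apply, hy]
    have h1 := h (l j) (l k)
    beta_reduce at h1
    rw [← hl, ← hl, ← map_mul, h1, map_sum]
    refine Finset.sum_congr rfl fun i _ => ?_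
    rw [Algebra.smul_def, map_mul, hf, ← map_mul (algebraMap K E), ← Algebra.smul_def]
  intro a b
  have := congrArg (fun T => T a b) hB
  simpa [B] using this

theorem muSym_pow_le {q n k : ℕ} (hq : IsPrimePow q) (hn : 0 < n) (hk : 0 < k) :
    ∃ m, k ≤ n * m ∧ muSym (q ^ n) m ≤ muSym q k := by
  obtain ⟨K, L, _, _, _, hK, hL, h⟩ := SymMulDecomp.out (dec_nonempty hq hk)
  have hq0 : q ≠ 0 := hq.ne_zero
  have : Finite K := Nat.finite_of_card_ne_zero (by rw [hK]; positivity)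
  have : Finite L := Nat.finite_of_card_ne_zero (by rw [hL]; positivity)
  obtain ⟨E, _, _, hE⟩ := exists_ext K n hn
  rw [hK] at hE
  have : Finite E := Nat.finite_of_card_ne_zero (by rw [hE]; positivity)
  obtain ⟨I, hI⟩ := Ideal.exists_maximal (TensorProduct K E L)
  let _ : Field (TensorProduct K E L ⧸ I) := Ideal.Quotient.field I
  let g : L →+* (TensorProduct K E L ⧸ I) := (Ideal.Quotient.mk I).comp
    (Algebra.TensorProduct.includeRight : L →ₐ[K] TensorProduct K E L).toRingHom
  have : Module.Finite K L := Module.Finite.of_finite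
  have : Module.Finite E (TensorProduct K E L) := inferInstance
  have : Module.Finite E (TensorProduct K E L ⧸ I) := inferInstance
  have : Finite (TensorProduct K E L ⧸ I) := Module.finite_of_finite E
  have hd := HasDec.baseChange (E := E) (M := TensorProduct K E L ⧸ I) g (by
      intro a
      change Ideal.Quotient.mk I (Algebra.TensorProduct.includeRight (algebraMap K L a)) =
        Ideal.Quotient.mk I (algebraMap E _ (algebraMap K E a))
      simp [← IsScalarTower.algebraMap_apply]) (by
      rintro t -
      obtain ⟨t, rfl⟩ := Ideal.Quotient.mk_surjective t
      induction t using TensorProduct.induction_on with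
      | zero => simp
      | add a b ha hb => rw [map_add]; exact add_mem ha hb
      | tmul a b =>
        have : Ideal.Quotient.mk I (a ⊗ₜ[K] b) = a • g b := by
          change _ = Ideal.Quotient.mk I (a • ((1 : E) ⊗ₜ[K] b))
          rw [TensorProduct.smul_tmul']
          simp
        rw [this]
        exact Submodule.smul_mem _ _ (Submodule.subset_span ⟨b, rfl⟩)) h
  have hM : Nat.card (TensorProduct K E L ⧸ I) =
      (q ^ n) ^ Module.finrank E (TensorProduct K E L ⧸ I) := by
    rw [← hE]; exact Module.natCard_eq_pow_finrank
  refine ⟨Module.finrank E (TensorProduct K E L ⧸ I), ?_, Nat.sInf_le (hd.mk' hE hM)⟩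
  have := Nat.card_le_card_of_injective g g.injective
  rw [hL, hM, ← pow_mul] at this
  exact (Nat.pow_le_pow_iff_right hq.one_lt).1 this

theorem mSym_nonneg (q : ℕ) : 0 ≤ mSym q := by
  unfold mSym
  rw [Filter.liminf_eq]
  by_cases hb : BddAbove {a : ℝ | ∀ᶠ k : ℕ in Filter.atTop, a ≤ (muSym q k : ℝ) / k}
  · exact le_csSup hb (Filter.Eventually.of_forall fun k => by positivity)
  · rw [Real.sSup_of_not_bddAbove hb]

theorem mSym_le (q n : ℕ) (hq : IsPrimePow q) (hn : 0 < n) :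
    mSym q ≤ mSym (q ^ n) * (muSym q n : ℝ) / n := by
  have hn' : (0 : ℝ) < n := by exact_mod_cast hn
  by_cases hb : BddAbove {a : ℝ | ∀ᶠ k : ℕ in Filter.atTop, a ≤ (muSym q k : ℝ) / k}
  swap
  · have h0 : mSym q = 0 := by
      unfold mSym
      rw [Filter.liminf_eq, Real.sSup_of_not_bddAbove hb]
    rw [h0]
    have := mSym_nonneg (q ^ n)
    positivity
  obtain ⟨C, hC⟩ := hb
  have hC0 : 0 ≤ C := hC (Filter.Eventually.of_forall fun k => by positivity)
  have hfreq : ∃ᶠ k : ℕ in Filter.atTop, (muSym q k : ℝ) / k < C + 1 := by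
    intro h
    have := hC (a := C + 1) (h.mono fun k hk => not_lt.1 hk)
    linarith
  have hfreq' : ∃ᶠ m : ℕ in Filter.atTop, (muSym (q ^ n) m : ℝ) / m ≤ n * (C + 1) := by
    rw [Filter.frequently_atTop] at hfreq ⊢
    intro N
    obtain ⟨k, hk, hkC⟩ := hfreq (n * N + 1)
    have hk0 : 0 < k := by omega
    obtain ⟨m, hm, hle⟩ := muSym_pow_le hq hn hk0
    refine ⟨m, ?_, ?_⟩
    · have : n * N < n * m := by omega
      exact (Nat.lt_of_mul_lt_mul_left this).le
    · have hm0 : 0 < m := Nat.pos_of_ne_zero (by rintro rfl; omega)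
      have hk' : (0 : ℝ) < k := by exact_mod_cast hk0
      have hm' : (0 : ℝ) < m := by exact_mod_cast hm0
      rw [div_lt_iff₀ hk'] at hkC
      rw [div_le_iff₀ hm']
      have h1 : (muSym (q ^ n) m : ℝ) ≤ muSym q k := by exact_mod_cast hle
      have h2 : (k : ℝ) ≤ n * m := by exact_mod_cast hm
      nlinarith
  have hcob : Filter.IsCoboundedUnder (· ≥ ·) Filter.atTop
      (fun m : ℕ => (muSym (q ^ n) m : ℝ) / m) :=
    Filter.IsCoboundedUnder.of_frequently_le hfreq'
  have hbd : Filter.IsBoundedUnder (· ≥ ·) Filter.atTop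
      (fun m : ℕ => (muSym q m : ℝ) / m) :=
    Filter.isBoundedUnder_of ⟨0, fun k => by positivity⟩
  have key : ∀ ε : ℝ, 0 < ε → mSym q ≤ (mSym (q ^ n) + ε) * ((muSym q n : ℝ) / n) := by
    intro ε hε
    have hlt : mSym (q ^ n) < mSym (q ^ n) + ε := by linarith
    have hf := Filter.frequently_lt_of_liminf_lt hcob hlt
    refine Filter.liminf_le_of_frequently_le ?_ hbd
    rw [Filter.frequently_atTop] at hf ⊢
    intro N
    obtain ⟨m, hm, hlt⟩ := hf (N + 1)
    refine ⟨n * m, by nlinarith, ?_⟩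
    have h1 : (muSym q (n * m) : ℝ) ≤ muSym (q ^ n) m * muSym q n := by
      exact_mod_cast muSym_mul_le hq hn (by omega : 0 < m)
    have hm' : (0 : ℝ) < m := by exact_mod_cast (by omega : 0 < m)
    calc (muSym q (n * m) : ℝ) / (n * m : ℕ)
        ≤ (muSym (q ^ n) m * muSym q n) / (n * m : ℕ) := by gcongr
      _ = (muSym (q ^ n) m / m) * (muSym q n / n) := by push_cast; field_simp
      _ ≤ _ := by gcongr
  rw [mul_div_assoc]
  refine le_of_forall_pos_le_add fun δ hδ => ?_
  have hA : (0 : ℝ) ≤ (muSym q n : ℝ) / n := by positivity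
  refine (key (δ / ((muSym q n : ℝ) / n + 1)) (by positivity)).trans ?_
  rw [add_mul]
  gcongr
  rw [div_mul_eq_mul_div, div_le_iff₀ (by positivity)]
  nlinarith
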